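/- arXiv:1110.5746 — 2 statements merged into one kernel-verified Lean document; each statement's English description precedes it below -/
import Mathlib

section
/- Suppose that for every finite ensemble of pure (rank-one) states on ℂ^{d_A}, the Holevo quantity with respect to N_B is at least the Holevo quantity with respect to N_E. Then C_p^{(1)}(N_B) = Q^{(1)}(N_B). -/
open Matrix BigOperators
open scoped ComplexOrder

noncomputable section

/-- Matrix logarithm via the spectral decomposition (junk value `0` off Hermitian matrices;
eigenvalue `0` contributes `Real.log 0 = 0`). -/
def matLog {n : Type*} [Fintype n] [DecidableEq n] (ρ : Matrix n n ℂ) : Matrix n n ℂ :=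
  if h : ρ.IsHermitian then
    (h.eigenvectorUnitary : Matrix n n ℂ) *
      Matrix.diagonal (fun i => (Real.log (h.eigenvalues i) : ℂ)) *
      (h.eigenvectorUnitary : Matrix n n ℂ)ᴴ
  else 0

/-- Von Neumann entropy `H(ρ) = -Tr[ρ log ρ]`. -/
def vnEntropy {n : Type*} [Fintype n] [DecidableEq n] (ρ : Matrix n n ℂ) : ℝ :=
  - (ρ * matLog ρ).trace.re

/-- Quantum relative entropy `D(ρ‖σ) = Tr[ρ (log ρ - log σ)]`. -/
def relEntropy {n : Type*} [Fintype n] [DecidableEq n] (ρ σ : Matrix n n ℂ) : ℝ :=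
  (ρ * (matLog ρ - matLog σ)).trace.re

/-- A state: positive semidefinite with unit trace. -/
def IsState {n : Type*} [Fintype n] (ρ : Matrix n n ℂ) : Prop :=
  ρ.PosSemidef ∧ ρ.trace = 1

/-- A pure (rank-one) state `|ψ⟩⟨ψ|` for a unit vector `ψ`. -/
def IsPureState {n : Type*} [Fintype n] (ρ : Matrix n n ℂ) : Prop :=
  ∃ ψ : n → ℂ, (∑ i, Complex.normSq (ψ i)) = 1 ∧ ρ = Matrix.vecMulVec ψ (star ψ)

/-- Support (range) inclusion for matrices. -/
def suppLE {n : Type*} [Fintype n] [DecidableEq n] (ρ σ : Matrix n n ℂ) : Prop :=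
  LinearMap.range (Matrix.toLin' ρ) ≤ LinearMap.range (Matrix.toLin' σ)

/-- Partial trace over the second tensor factor. -/
def ptraceSnd {α β : Type*} [Fintype β] (M : Matrix (α × β) (α × β) ℂ) : Matrix α α ℂ :=
  Matrix.of fun i j => ∑ k, M (i, k) (j, k)

/-- Partial trace over the first tensor factor. -/
def ptraceFst {α β : Type*} [Fintype α] (M : Matrix (α × β) (α × β) ℂ) : Matrix β β ℂ :=
  Matrix.of fun i j => ∑ k, M (k, i) (k, j)

variable {dA dB dE : ℕ}

/-- The channel `N_B(ρ) = Tr_E[U ρ U†]`. -/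
def chanB (U : Matrix (Fin dB × Fin dE) (Fin dA) ℂ) (ρ : Matrix (Fin dA) (Fin dA) ℂ) :
    Matrix (Fin dB) (Fin dB) ℂ := ptraceSnd (U * ρ * Uᴴ)

/-- The complementary channel `N_E(ρ) = Tr_B[U ρ U†]`. -/
def chanE (U : Matrix (Fin dB × Fin dE) (Fin dA) ℂ) (ρ : Matrix (Fin dA) (Fin dA) ℂ) :
    Matrix (Fin dE) (Fin dE) ℂ := ptraceFst (U * ρ * Uᴴ)

/-- Coherent information `I_c(ρ) = H(N_B(ρ)) - H(N_E(ρ))`. -/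
def cohInfo (U : Matrix (Fin dB × Fin dE) (Fin dA) ℂ) (ρ : Matrix (Fin dA) (Fin dA) ℂ) : ℝ :=
  vnEntropy (chanB U ρ) - vnEntropy (chanE U ρ)

/-- Holevo quantity of the ensemble `(p, σ)` with respect to the channel `N`. -/
def holevo {ι inn out : Type*} [Fintype ι] [Fintype out] [DecidableEq out]
    [AddCommMonoid (Matrix inn inn ℂ)]
    (N : Matrix inn inn ℂ → Matrix out out ℂ)
    (p : ι → ℝ) (σ : ι → Matrix inn inn ℂ) : ℝ :=
  vnEntropy (N (∑ u, (p u : ℂ) • σ u)) - ∑ u, p u * vnEntropy (N (σ u))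

/-- A finite ensemble: a probability distribution together with states. -/
def IsEnsemble {ι inn : Type*} [Fintype ι] [Fintype inn]
    (p : ι → ℝ) (σ : ι → Matrix inn inn ℂ) : Prop :=
  (∀ u, 0 ≤ p u) ∧ (∑ u, p u = 1) ∧ (∀ u, IsState (σ u))

/-- `Q^{(1)}`: optimized coherent information. -/
def Q1 (U : Matrix (Fin dB × Fin dE) (Fin dA) ℂ) : ℝ :=
  sSup { r | ∃ ρ, IsState ρ ∧ r = cohInfo U ρ }

/-- `C_p^{(1)}`: optimized difference of Holevo quantities. -/
def Cp1 (U : Matrix (Fin dB × Fin dE) (Fin dA) ℂ) : ℝ :=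
  sSup { r | ∃ (m : ℕ) (p : Fin m → ℝ) (σ : Fin m → Matrix (Fin dA) (Fin dA) ℂ),
    IsEnsemble p σ ∧ r = holevo (chanB U) p σ - holevo (chanE U) p σ }

theorem aux_spec {n : Type*} [Fintype n] [DecidableEq n] {ρ : Matrix n n ℂ} (h : ρ.IsHermitian) :
    ρ = (h.eigenvectorUnitary : Matrix n n ℂ) *
      Matrix.diagonal (fun i => (h.eigenvalues i : ℂ)) *
      (h.eigenvectorUnitary : Matrix n n ℂ)ᴴ := by
  have := h.spectral_theorem
  rw [Unitary.conjStarAlgAut_apply] at this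
  exact this

theorem aux_ent {n : Type*} [Fintype n] [DecidableEq n] {ρ : Matrix n n ℂ} (h : ρ.IsHermitian) :
    vnEntropy ρ = (ρ.charpoly.roots.map (fun z : ℂ => Real.negMulLog z.re)).sum := by
  have hu : (h.eigenvectorUnitary : Matrix n n ℂ)ᴴ * (h.eigenvectorUnitary : Matrix n n ℂ) = 1 :=
    Unitary.coe_star_mul_self h.eigenvectorUnitary
  rw [h.roots_charpoly_eq_eigenvalues]
  unfold vnEntropy matLog
  rw [dif_pos h]
  nth_rewrite 1 [aux_spec h]
  generalize (h.eigenvectorUnitary : Matrix n n ℂ) = V at hu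
  have : V * Matrix.diagonal (fun i => (h.eigenvalues i : ℂ)) * Vᴴ *
      (V * Matrix.diagonal (fun i => (Real.log (h.eigenvalues i) : ℂ)) * Vᴴ)
      = V * (Matrix.diagonal (fun i => (h.eigenvalues i : ℂ)) *
        Matrix.diagonal (fun i => (Real.log (h.eigenvalues i) : ℂ)) * Vᴴ) := by
    calc _ = V * Matrix.diagonal (fun i => (h.eigenvalues i : ℂ)) * (Vᴴ * V) *
      (Matrix.diagonal (fun i => (Real.log (h.eigenvalues i) : ℂ)) * Vᴴ) := by
          simp only [Matrix.mul_assoc]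
      _ = _ := by rw [hu]; simp only [Matrix.mul_assoc, Matrix.mul_one]
  rw [this, Matrix.trace_mul_comm, Matrix.mul_assoc, hu, Matrix.mul_one,
    Matrix.diagonal_mul_diagonal, Matrix.trace_diagonal]
  simp only [Multiset.map_map, Complex.re_sum]
  rw [← Finset.sum_neg_distrib]
  apply Finset.sum_congr rfl
  intro i _
  simp [Real.negMulLog, ← Complex.ofReal_mul]

theorem aux_swap {m n : Type*} [Fintype m] [DecidableEq m] [Fintype n] [DecidableEq n]
    (A : Matrix m n ℂ) : vnEntropy (A * Aᴴ) = vnEntropy (Aᵀ * Aᵀᴴ) := by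
  rw [aux_ent (Matrix.isHermitian_mul_conjTranspose_self A),
    aux_ent (Matrix.isHermitian_mul_conjTranspose_self Aᵀ)]
  have h2 : (Aᵀ * Aᵀᴴ).charpoly = (Aᴴ * A).charpoly := by
    rw [← Matrix.charpoly_transpose, Matrix.transpose_mul]
    rfl
  rw [h2]
  have h := Matrix.charpoly_mul_comm' A Aᴴ
  have h3 := congrArg (fun q : Polynomial ℂ =>
    (q.roots.map (fun z : ℂ => Real.negMulLog z.re)).sum) h
  rw [Polynomial.roots_mul (mul_ne_zero (pow_ne_zero _ Polynomial.X_ne_zero)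
      (Matrix.charpoly_monic _).ne_zero),
    Polynomial.roots_mul (mul_ne_zero (pow_ne_zero _ Polynomial.X_ne_zero)
      (Matrix.charpoly_monic _).ne_zero)] at h3
  simpa [Polynomial.roots_X_pow, Multiset.map_nsmul, Multiset.sum_nsmul] using h3

theorem aux_pure (U : Matrix (Fin dB × Fin dE) (Fin dA) ℂ) {ρ : Matrix (Fin dA) (Fin dA) ℂ}
    (h : IsPureState ρ) : cohInfo U ρ = 0 := by
  obtain ⟨ψ, -, rfl⟩ := h
  have e : U * Matrix.vecMulVec ψ (star ψ) * Uᴴ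
      = Matrix.vecMulVec (U *ᵥ ψ) (star (U *ᵥ ψ)) := by
    rw [Matrix.mul_vecMulVec, Matrix.vecMulVec_mul, Matrix.star_mulVec]
  let A : Matrix (Fin dB) (Fin dE) ℂ := Matrix.of fun i k => (U *ᵥ ψ) (i, k)
  have hB : chanB U (Matrix.vecMulVec ψ (star ψ)) = A * Aᴴ := by
    unfold chanB
    rw [e]
    ext i j
    simp [ptraceSnd, Matrix.mul_apply, A, Matrix.vecMulVec_apply]
  have hE : chanE U (Matrix.vecMulVec ψ (star ψ)) = Aᵀ * Aᵀᴴ := by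
    unfold chanE
    rw [e]
    ext i j
    simp [ptraceFst, Matrix.mul_apply, A, Matrix.vecMulVec_apply]
  unfold cohInfo
  rw [hB, hE, aux_swap, sub_self]

theorem aux_pure_state {n : Type*} [Fintype n] {ρ : Matrix n n ℂ}
    (h : IsPureState ρ) : IsState ρ := by
  obtain ⟨ψ, h1, rfl⟩ := h
  refine ⟨Matrix.posSemidef_vecMulVec_self_star ψ, ?_⟩
  rw [Matrix.trace_vecMulVec, dotProduct]
  have : ((∑ i, Complex.normSq (ψ i) : ℝ) : ℂ) = 1 := by rw [h1]; simp
  rw [← this]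
  push_cast
  exact Finset.sum_congr rfl fun i _ => by simp [Complex.mul_conj]

theorem aux_diff {m : ℕ} (U : Matrix (Fin dB × Fin dE) (Fin dA) ℂ) (p : Fin m → ℝ)
    (σ : Fin m → Matrix (Fin dA) (Fin dA) ℂ) :
    holevo (chanB U) p σ - holevo (chanE U) p σ
      = cohInfo U (∑ u, (p u : ℂ) • σ u) - ∑ u, p u * cohInfo U (σ u) := by
  unfold holevo cohInfo
  simp only [mul_sub, Finset.sum_sub_distrib]
  ring

theorem aux_avg {m : ℕ} {p : Fin m → ℝ}
    {σ : Fin m → Matrix (Fin dA) (Fin dA) ℂ} (h : IsEnsemble p σ) :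
    IsState (∑ u, (p u : ℂ) • σ u) := by
  obtain ⟨h0, h1, h2⟩ := h
  refine ⟨Matrix.posSemidef_sum _ fun u _ => (h2 u).1.smul ?_, ?_⟩
  · exact_mod_cast h0 u
  · simp only [Matrix.trace_sum, Matrix.trace_smul, (h2 _).2, smul_eq_mul, mul_one]
    exact_mod_cast h1

theorem aux_decomp {ρ : Matrix (Fin dA) (Fin dA) ℂ} (h : IsState ρ) :
    ∃ (p : Fin dA → ℝ) (σ : Fin dA → Matrix (Fin dA) (Fin dA) ℂ),
      IsEnsemble p σ ∧ (∀ u, IsPureState (σ u)) ∧ ∑ u, (p u : ℂ) • σ u = ρ := by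
  obtain ⟨hp, ht⟩ := h
  have hh := hp.isHermitian
  let V : Matrix (Fin dA) (Fin dA) ℂ := hh.eigenvectorUnitary
  have hV : Vᴴ * V = 1 := Unitary.coe_star_mul_self hh.eigenvectorUnitary
  let σ : Fin dA → Matrix (Fin dA) (Fin dA) ℂ :=
    fun u => Matrix.vecMulVec (fun i => V i u) (star fun i => V i u)
  have hpure : ∀ u, IsPureState (σ u) := by
    intro u
    refine ⟨fun i => V i u, ?_, rfl⟩
    have := congrFun (congrFun hV u) u
    simp only [Matrix.mul_apply, Matrix.conjTranspose_apply, Matrix.one_apply_eq] at this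
    have h3 : ((∑ i, Complex.normSq (V i u) : ℝ) : ℂ) = 1 := by
      rw [← this]
      push_cast
      exact Finset.sum_congr rfl fun i _ => by
        rw [Complex.normSq_eq_conj_mul_self]; rfl
    exact_mod_cast h3
  refine ⟨hh.eigenvalues, σ, ⟨hp.eigenvalues_nonneg, ?_, fun u => aux_pure_state (hpure u)⟩,
    hpure, ?_⟩
  · have := hh.trace_eq_sum_eigenvalues
    rw [ht] at this
    have h4 : ((∑ i, hh.eigenvalues i : ℝ) : ℂ) = 1 := by
      rw [this]; push_cast; rfl
    exact_mod_cast h4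
  · conv_rhs => rw [aux_spec hh]
    ext i j
    rw [Matrix.mul_apply]
    simp only [Matrix.sum_apply, Matrix.smul_apply, Matrix.mul_diagonal,
      Matrix.conjTranspose_apply, smul_eq_mul, σ, Matrix.vecMulVec_apply, Pi.star_apply, V]
    exact Finset.sum_congr rfl fun u _ => by ring

/-- If every finite ensemble of pure states on `ℂ^{d_A}` has Holevo quantity
w.r.t. `N_B` at least that w.r.t. `N_E`, then `C_p^{(1)}(N_B) = Q^{(1)}(N_B)`. -/
theorem pure_more_capable_implies_Cp1_eq_Q1
    {dA dB dE : ℕ} (hdA : 1 ≤ dA) (hdB : 1 ≤ dB) (hdE : 1 ≤ dE)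
    (U : Matrix (Fin dB × Fin dE) (Fin dA) ℂ) (hU : Uᴴ * U = 1)
    (hmc : ∀ (m : ℕ) (p : Fin m → ℝ) (σ : Fin m → Matrix (Fin dA) (Fin dA) ℂ),
      IsEnsemble p σ → (∀ u, IsPureState (σ u)) →
      holevo (chanE U) p σ ≤ holevo (chanB U) p σ) :
    Cp1 U = Q1 U := by
  have hdec : ∀ ρ, IsState ρ → ∃ (p : Fin dA → ℝ) (σ : Fin dA → Matrix (Fin dA) (Fin dA) ℂ),
      IsEnsemble p σ ∧ (∀ u, IsPureState (σ u)) ∧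
      holevo (chanB U) p σ - holevo (chanE U) p σ = cohInfo U ρ := by
    intro ρ hρ
    obtain ⟨p, σ, h1, h2, h3⟩ := aux_decomp hρ
    refine ⟨p, σ, h1, h2, ?_⟩
    rw [aux_diff, h3]
    simp [aux_pure U (h2 _)]
  have hpos : ∀ ρ, IsState ρ → 0 ≤ cohInfo U ρ := by
    intro ρ hρ
    obtain ⟨p, σ, h1, h2, h3⟩ := hdec ρ hρ
    have := hmc _ p σ h1 h2
    linarith
  unfold Cp1 Q1
  apply csSup_eq_csSup_of_forall_exists_le
  · rintro r ⟨m, p, σ, h, rfl⟩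
    refine ⟨_, ⟨_, aux_avg h, rfl⟩, ?_⟩
    rw [aux_diff]
    have : 0 ≤ ∑ u, p u * cohInfo U (σ u) :=
      Finset.sum_nonneg fun u _ => mul_nonneg (h.1 u) (hpos _ (h.2.2 u))
    linarith
  · rintro r ⟨ρ, hρ, rfl⟩
    obtain ⟨p, σ, h1, h2, h3⟩ := hdec ρ hρ
    exact ⟨_, ⟨_, p, σ, h1, rfl⟩, h3.ge⟩

end
end

section
/- Let {(P(x), |ψ_x⟩⟨ψ_x|)} be any finite ensemble of pure (rank-one) states on ℂ^{d_A} with average state ρ = Σ_x P(x) |ψ_x⟩⟨ψ_x|. Then the difference of Holevo quantities of this ensemble equals the coherent information of ρ: χ(N_B) - χ(N_E) = I_c(ρ). Consequently Q^{(1)}(N_B) ≤ C_p^{(1)}(N_B). -/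
open Matrix BigOperators
open scoped ComplexOrder

noncomputable section

variable {dA dB dE : ℕ}

lemma vnEntropy_eq_sum {n : Type*} [Fintype n] [DecidableEq n] (ρ : Matrix n n ℂ)
    (h : ρ.IsHermitian) : vnEntropy ρ = ∑ i, Real.negMulLog (h.eigenvalues i) := by
  have hsp := h.spectral_theorem
  rw [Unitary.conjStarAlgAut_apply] at hsp
  have hV : (h.eigenvectorUnitary : Matrix n n ℂ)ᴴ * (h.eigenvectorUnitary : Matrix n n ℂ) = 1 :=
    Unitary.coe_star_mul_self h.eigenvectorUnitary
  have key : (ρ * matLog ρ).trace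
      = ∑ i, (h.eigenvalues i : ℂ) * (Real.log (h.eigenvalues i) : ℂ) := by
    unfold matLog
    rw [dif_pos h]
    set V : Matrix n n ℂ := (h.eigenvectorUnitary : Matrix n n ℂ) with hVdef
    set D : Matrix n n ℂ := diagonal (RCLike.ofReal ∘ h.eigenvalues) with hD
    set L : Matrix n n ℂ := diagonal (fun i => (Real.log (h.eigenvalues i) : ℂ)) with hL
    have hsp' : ρ = V * D * Vᴴ := hsp
    have e : ρ * (V * L * Vᴴ) = V * (D * L) * Vᴴ := by
      calc ρ * (V * L * Vᴴ) = (V * D * Vᴴ) * (V * L * Vᴴ) := by rw [← hsp']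
        _ = V * D * (Vᴴ * V) * L * Vᴴ := by simp only [Matrix.mul_assoc]
        _ = _ := by rw [hV]; simp only [Matrix.mul_assoc, Matrix.mul_one, Matrix.one_mul]
    rw [e, Matrix.trace_mul_comm, ← Matrix.mul_assoc, hV, Matrix.one_mul, hD, hL,
      Matrix.diagonal_mul_diagonal, Matrix.trace_diagonal]
    rfl
  unfold vnEntropy
  rw [key, Complex.re_sum, ← Finset.sum_neg_distrib]
  refine Finset.sum_congr rfl fun i _ => ?_
  rw [← Complex.ofReal_mul, Complex.ofReal_re, Real.negMulLog]
  ring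

lemma vnEntropy_eq_roots {n : Type*} [Fintype n] [DecidableEq n] (ρ : Matrix n n ℂ)
    (h : ρ.IsHermitian) :
    vnEntropy ρ = (ρ.charpoly.roots.map (fun z => Real.negMulLog z.re)).sum := by
  rw [vnEntropy_eq_sum ρ h, h.roots_charpoly_eq_eigenvalues, Multiset.map_map]
  rfl

lemma vnEntropy_nonneg {n : Type*} [Fintype n] [DecidableEq n] (ρ : Matrix n n ℂ)
    (h : IsState ρ) : 0 ≤ vnEntropy ρ := by
  have hH := h.1.1
  rw [vnEntropy_eq_sum ρ hH]
  have hs : ∑ i, hH.eigenvalues i = 1 := by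
    have := hH.trace_eq_sum_eigenvalues
    rw [h.2] at this
    have h2 := congrArg Complex.re this
    rw [Complex.re_sum] at h2
    simpa using h2.symm
  refine Finset.sum_nonneg fun i _ => Real.negMulLog_nonneg (h.1.eigenvalues_nonneg i) ?_
  rw [← hs]
  exact Finset.single_le_sum (f := hH.eigenvalues)
    (fun j _ => h.1.eigenvalues_nonneg j) (Finset.mem_univ i)

lemma vnEntropy_le {n : Type*} [Fintype n] [DecidableEq n] (ρ : Matrix n n ℂ)
    (h : IsState ρ) : vnEntropy ρ ≤ Fintype.card n := by
  rw [vnEntropy_eq_sum ρ h.1.1]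
  calc _ ≤ ∑ _i : n, (1 : ℝ) := Finset.sum_le_sum fun i _ => by
        have h0 := h.1.eigenvalues_nonneg i
        have := Real.negMulLog_le_one_sub_self h0
        linarith
    _ = _ := by simp

lemma vnEntropy_mul_comm {m n : Type*} [Fintype n] [DecidableEq n] [Fintype m] [DecidableEq m]
    (M : Matrix m n ℂ) : vnEntropy (M * Mᴴ) = vnEntropy (Mᴴ * M)ᵀ := by
  have h1 : (M * Mᴴ).IsHermitian := Matrix.isHermitian_mul_conjTranspose_self M
  have h2 : ((Mᴴ * M)ᵀ).IsHermitian := (Matrix.isHermitian_conjTranspose_mul_self M).transpose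
  rw [vnEntropy_eq_roots _ h1, vnEntropy_eq_roots _ h2, Matrix.charpoly_transpose]
  have h := congrArg (fun p : Polynomial ℂ => (p.roots.map (fun z => Real.negMulLog z.re)).sum)
    (Matrix.charpoly_mul_comm' M Mᴴ)
  have n1 := (Matrix.charpoly_monic (M * Mᴴ)).ne_zero
  have n2 := (Matrix.charpoly_monic (Mᴴ * M)).ne_zero
  have nX : ∀ k : ℕ, (Polynomial.X : Polynomial ℂ) ^ k ≠ 0 := fun k =>
    pow_ne_zero _ Polynomial.X_ne_zero
  simp only [Polynomial.roots_mul (mul_ne_zero (nX _) n1),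
    Polynomial.roots_mul (mul_ne_zero (nX _) n2), Multiset.map_add, Multiset.sum_add,
    Polynomial.roots_pow, Polynomial.roots_X, Multiset.map_nsmul, Multiset.sum_nsmul,
    Multiset.map_singleton, Multiset.sum_singleton, Complex.zero_re, Real.negMulLog_zero,
    smul_zero, zero_add] at h
  exact h

lemma vnEntropy_pure (U : Matrix (Fin dB × Fin dE) (Fin dA) ℂ) (ψ : Fin dA → ℂ) :
    vnEntropy (chanB U (vecMulVec ψ (star ψ))) = vnEntropy (chanE U (vecMulVec ψ (star ψ))) := by
  set M : Matrix (Fin dB) (Fin dE) ℂ := Matrix.of fun b e => (U *ᵥ ψ) (b, e) with hM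
  have e0 : U * vecMulVec ψ (star ψ) * Uᴴ = vecMulVec (U *ᵥ ψ) (star (U *ᵥ ψ)) := by
    rw [Matrix.mul_vecMulVec, Matrix.vecMulVec_mul, Matrix.star_mulVec]
  have e1 : chanB U (vecMulVec ψ (star ψ)) = M * Mᴴ := by
    ext i j
    rw [chanB, e0]
    simp [ ptraceSnd, Matrix.mul_apply, vecMulVec_apply, hM]
  have e2 : chanE U (vecMulVec ψ (star ψ)) = (Mᴴ * M)ᵀ := by
    ext i j
    rw [chanE, e0]
    simp [ ptraceFst, Matrix.mul_apply, vecMulVec_apply, hM, mul_comm]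
  rw [e1, e2, vnEntropy_mul_comm]

lemma chanB_state (U : Matrix (Fin dB × Fin dE) (Fin dA) ℂ) (hU : Uᴴ * U = 1)
    (ρ : Matrix (Fin dA) (Fin dA) ℂ) (h : IsState ρ) : IsState (chanB U ρ) := by
  have hp := h.1.mul_mul_conjTranspose_same U
  constructor
  · have : chanB U ρ = ∑ k, (U * ρ * Uᴴ).submatrix (fun i => (i, k)) (fun i => (i, k)) := by
      ext i j
      simp [chanB, ptraceSnd, Matrix.sum_apply]
    rw [this]
    exact Matrix.posSemidef_sum _ fun k _ => hp.submatrix _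
  · have : (chanB U ρ).trace = (U * ρ * Uᴴ).trace := by
      simp [chanB, ptraceSnd, Matrix.trace, Fintype.sum_prod_type]
    rw [this, Matrix.trace_mul_comm, ← Matrix.mul_assoc, hU, Matrix.one_mul, h.2]

lemma chanE_state (U : Matrix (Fin dB × Fin dE) (Fin dA) ℂ) (hU : Uᴴ * U = 1)
    (ρ : Matrix (Fin dA) (Fin dA) ℂ) (h : IsState ρ) : IsState (chanE U ρ) := by
  have hp := h.1.mul_mul_conjTranspose_same U
  constructor
  · have : chanE U ρ = ∑ k, (U * ρ * Uᴴ).submatrix (fun i => (k, i)) (fun i => (k, i)) := by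
      ext i j
      simp [chanE, ptraceFst, Matrix.sum_apply]
    rw [this]
    exact Matrix.posSemidef_sum _ fun k _ => hp.submatrix _
  · have : (chanE U ρ).trace = (U * ρ * Uᴴ).trace := by
      simp [chanE, ptraceFst, Matrix.trace, Fintype.sum_prod_type_right]
    rw [this, Matrix.trace_mul_comm, ← Matrix.mul_assoc, hU, Matrix.one_mul, h.2]

lemma avg_state {m n : ℕ} (p : Fin m → ℝ) (σ : Fin m → Matrix (Fin n) (Fin n) ℂ)
    (h : IsEnsemble p σ) : IsState (∑ u, (p u : ℂ) • σ u) := by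
  obtain ⟨h0, h1, h2⟩ := h
  constructor
  · refine Matrix.posSemidef_sum _ fun k _ => (h2 k).1.smul ?_
    exact_mod_cast h0 k
  · rw [Matrix.trace_sum]
    simp only [Matrix.trace_smul, (h2 _).2, smul_eq_mul, mul_one]
    exact_mod_cast h1

lemma pure_state {n : ℕ} (ψ : Fin n → ℂ) (h : (∑ i, Complex.normSq (ψ i)) = 1) :
    IsState (vecMulVec ψ (star ψ)) := by
  constructor
  · exact Matrix.posSemidef_vecMulVec_self_star ψ
  · rw [Matrix.trace]
    simp only [Matrix.diag_apply, vecMulVec_apply, Pi.star_apply, RCLike.star_def, Complex.mul_conj]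
    exact_mod_cast h

lemma holevo_diff_pure (U : Matrix (Fin dB × Fin dE) (Fin dA) ℂ)
    (m : ℕ) (P : Fin m → ℝ) (ψ : Fin m → Fin dA → ℂ) :
    holevo (chanB U) P (fun x => Matrix.vecMulVec (ψ x) (star (ψ x)))
        - holevo (chanE U) P (fun x => Matrix.vecMulVec (ψ x) (star (ψ x)))
      = cohInfo U (∑ x, (P x : ℂ) • Matrix.vecMulVec (ψ x) (star (ψ x))) := by
  unfold holevo cohInfo
  simp only [vnEntropy_pure]
  ring

lemma bddAbove_Cp1 (U : Matrix (Fin dB × Fin dE) (Fin dA) ℂ) (hU : Uᴴ * U = 1) :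
    BddAbove { r | ∃ (m : ℕ) (p : Fin m → ℝ) (σ : Fin m → Matrix (Fin dA) (Fin dA) ℂ),
    IsEnsemble p σ ∧ r = holevo (chanB U) p σ - holevo (chanE U) p σ } := by
  refine ⟨dB + dE, ?_⟩
  rintro r ⟨m, p, σ, h, rfl⟩
  have ha := avg_state p σ h
  have b1 := vnEntropy_le _ (chanB_state U hU _ ha)
  have b2 := vnEntropy_nonneg _ (chanE_state U hU _ ha)
  have b3 : 0 ≤ ∑ u, p u * vnEntropy (chanB U (σ u)) := Finset.sum_nonneg fun u _ =>
    mul_nonneg (h.1 u) (vnEntropy_nonneg _ (chanB_state U hU _ (h.2.2 u)))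
  have b4 : ∑ u, p u * vnEntropy (chanE U (σ u)) ≤ dE := by
    calc _ ≤ ∑ u, p u * (dE : ℝ) := Finset.sum_le_sum fun u _ =>
          mul_le_mul_of_nonneg_left
            (by simpa using vnEntropy_le _ (chanE_state U hU _ (h.2.2 u))) (h.1 u)
      _ = dE := by rw [← Finset.sum_mul, h.2.1, one_mul]
  rw [Fintype.card_fin] at b1
  unfold holevo
  linarith

lemma exists_pure_decomp {n : ℕ} (ρ : Matrix (Fin n) (Fin n) ℂ) (h : IsState ρ) :
    ∃ (p : Fin n → ℝ) (ψ : Fin n → Fin n → ℂ), (∀ x, 0 ≤ p x) ∧ (∑ x, p x = 1) ∧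
      (∀ x, (∑ i, Complex.normSq (ψ x i)) = 1) ∧
      ρ = ∑ x, (p x : ℂ) • vecMulVec (ψ x) (star (ψ x)) := by
  have hH := h.1.1
  have hsp := hH.spectral_theorem
  rw [Unitary.conjStarAlgAut_apply] at hsp
  set V : Matrix (Fin n) (Fin n) ℂ := (hH.eigenvectorUnitary : Matrix (Fin n) (Fin n) ℂ) with hVdef
  have hV : Vᴴ * V = 1 := Unitary.coe_star_mul_self hH.eigenvectorUnitary
  have hsp' : ρ = V * diagonal (RCLike.ofReal ∘ hH.eigenvalues) * Vᴴ := hsp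
  refine ⟨hH.eigenvalues, fun x i => V i x, h.1.eigenvalues_nonneg, ?_, ?_, ?_⟩
  · have := hH.trace_eq_sum_eigenvalues
    rw [h.2] at this
    have h2 := congrArg Complex.re this
    rw [Complex.re_sum] at h2
    simpa using h2.symm
  · intro x
    have h3 := congrFun (congrFun hV x) x
    rw [Matrix.mul_apply, Matrix.one_apply_eq] at h3
    simp only [Matrix.conjTranspose_apply, RCLike.star_def, ← Complex.normSq_eq_conj_mul_self] at h3
    exact_mod_cast h3
  · conv_lhs => rw [hsp']
    ext i j
    rw [Matrix.mul_apply, Matrix.sum_apply]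
    refine Finset.sum_congr rfl fun x _ => ?_
    simp [Matrix.mul_diagonal, vecMulVec_apply]
    ring

/-- For any finite ensemble of pure states `{(P(x), |ψ_x⟩⟨ψ_x|)}` with
average `ρ`, the difference of Holevo quantities equals the coherent information of `ρ`;
consequently `Q^{(1)}(N_B) ≤ C_p^{(1)}(N_B)`. -/
theorem pure_ensemble_holevo_diff_eq_cohInfo
    {dA dB dE : ℕ} (hdA : 1 ≤ dA) (hdB : 1 ≤ dB) (hdE : 1 ≤ dE)
    (U : Matrix (Fin dB × Fin dE) (Fin dA) ℂ) (hU : Uᴴ * U = 1)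
    (m : ℕ) (P : Fin m → ℝ) (ψ : Fin m → Fin dA → ℂ)
    (hP : ∀ x, 0 ≤ P x) (hPsum : ∑ x, P x = 1)
    (hψ : ∀ x, (∑ i, Complex.normSq (ψ x i)) = 1) :
    (holevo (chanB U) P (fun x => Matrix.vecMulVec (ψ x) (star (ψ x)))
        - holevo (chanE U) P (fun x => Matrix.vecMulVec (ψ x) (star (ψ x)))
      = cohInfo U (∑ x, (P x : ℂ) • Matrix.vecMulVec (ψ x) (star (ψ x))))
    ∧ Q1 U ≤ Cp1 U := by
  refine ⟨holevo_diff_pure U m P ψ, ?_⟩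
  unfold Q1 Cp1
  have hens : IsEnsemble P (fun x => vecMulVec (ψ x) (star (ψ x))) :=
    ⟨hP, hPsum, fun x => pure_state _ (hψ x)⟩
  refine csSup_le ⟨_, _, avg_state P _ hens, rfl⟩ ?_
  rintro r ⟨ρ, hρ, rfl⟩
  obtain ⟨p, φ, h0, h1, h2, h3⟩ := exists_pure_decomp ρ hρ
  refine le_csSup (bddAbove_Cp1 U hU)
    ⟨dA, p, fun x => vecMulVec (φ x) (star (φ x)), ⟨h0, h1, fun x => pure_state _ (h2 x)⟩, ?_⟩
  rw [holevo_diff_pure, ← h3]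

end
end
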